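/- Let T be a rooted tree with a leaf-labelling φ : L(T) → {x_1,…,x_n} (different leaves may receive the same label), and define λ_L : V(T) → {x_1,…,x_n} ∪ {y} by λ_L(v) = y if v is an internal vertex and λ_L(v) = φ(v) if v is a leaf. Then (T,λ_L) is a special pair and P(T,λ_L) = B_l(T), where B_l is defined recursively by B_l(•_j) = x_j for a single-vertex tree labelled x_j and B_l(T) = y + ∏_{i=1}^k B_l(T_i) for T = ∧(T_1,...,T_k). Consequently, B_l is a complete invariant for leaf-labelled rooted trees: B_l(T) = B_l(T') if and only if there is a digraph isomorphism between T and T' preserving the leaf labels. -/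

import Mathlib

/-- A rooted tree whose vertices carry labels from `K`. -/
inductive RTree (K : Type) : Type where
  | node : K → List (RTree K) → RTree K

namespace RTree

mutual
/-- The polynomial `P(T,λ)` of a vertex-labelled rooted tree. -/
noncomputable def P {K : Type} : RTree K → MvPolynomial K ℤ
  | .node k [] => MvPolynomial.X k
  | .node k (t :: ts) => MvPolynomial.X k + Pprod (t :: ts)
termination_by t => sizeOf t
/-- Product of the polynomials of a list of labelled trees. -/
noncomputable def Pprod {K : Type} : List (RTree K) → MvPolynomial K ℤ
  | [] => 1
  | t :: ts => P t * Pprod ts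
termination_by l => sizeOf l
end

/-- Isomorphism of vertex-labelled rooted trees: roots have the same label and
the children correspond bijectively by isomorphisms. -/
inductive Iso {K : Type} : RTree K → RTree K → Prop
  | node (k : K) (ts ts' : List (RTree K)) (e : Fin ts.length ≃ Fin ts'.length)
      (h : ∀ i : Fin ts.length, Iso (ts.get i) (ts'.get (e i))) :
      Iso (.node k ts) (.node k ts')

end RTree

/-- The variables: leaf variables `x i`, the variables `y`, `z`, and a set `S`
of further variables (all pairwise distinct). -/
inductive Var (S : Type) : Type where
  | x : ℕ → Var S
  | y : Var S
  | z : Var S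
  | s : S → Var S

mutual
/-- `SpecialAux b T` says the vertex-labelled tree `T` is special; the flag `b`
records whether the (virtual) parent of the root has outdegree 1. -/
def SpecialAux {S : Type} : Bool → RTree (Var S) → Prop
  | _, .node k [] => ∃ i, k = Var.x i
  | b, .node k [t] => (k = Var.y ∨ (b = false ∧ k = Var.z)) ∧ SpecialAux true t
  | _, .node k (t₁ :: t₂ :: ts) =>
      (k = Var.y ∨ k = Var.z ∨ ∃ a, k = Var.s a) ∧ SpecialList (t₁ :: t₂ :: ts)
/-- All trees in the list are special (as non-string-continuation subtrees). -/
def SpecialList {S : Type} : List (RTree (Var S)) → Prop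
  | [] => True
  | t :: ts => SpecialAux false t ∧ SpecialList ts
end

/-- A special pair: leaves are labelled by variables `x i`, a string
`(w₁,…,w_p)` is labelled so that `λ(w₁) ∈ {y,z}` and `λ(w_i) = y` for `i ≥ 2`,
and all remaining vertices have labels in `{y,z} ∪ S`. -/
def IsSpecial {S : Type} (T : RTree (Var S)) : Prop := SpecialAux false T


/- A leaf-labelled rooted tree is encoded as an `RTree ℕ` in which the label
`i` of a leaf stands for the variable `x_i` (different leaves may carry the
same label) and the labels of internal vertices are irrelevant. -/
mutual
/-- The labelling `λ_L`: every internal vertex gets label `y` and every leaf `v`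
gets label `x (φ v)`, where `φ v` is the leaf-label carried by `v`. -/
def leafLabel {S : Type} : RTree ℕ → RTree (Var S)
  | .node i [] => .node (Var.x i) []
  | .node _ (t :: ts) => .node Var.y (leafLabelList (t :: ts))
termination_by t => sizeOf t
def leafLabelList {S : Type} : List (RTree ℕ) → List (RTree (Var S))
  | [] => []
  | t :: ts => leafLabel t :: leafLabelList ts
termination_by l => sizeOf l
end

mutual
/-- Liu's polynomial `B_l` for leaf-labelled rooted trees:
`B_l(•_j) = x_j` and `B_l(∧(T₁,…,T_k)) = y + ∏ᵢ B_l(Tᵢ)`. -/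
noncomputable def Bl {S : Type} : RTree ℕ → MvPolynomial (Var S) ℤ
  | .node i [] => MvPolynomial.X (Var.x i)
  | .node _ (t :: ts) => MvPolynomial.X Var.y + BlProd (t :: ts)
termination_by t => sizeOf t
noncomputable def BlProd {S : Type} : List (RTree ℕ) → MvPolynomial (Var S) ℤ
  | [] => 1
  | t :: ts => Bl t * BlProd ts
termination_by l => sizeOf l
end

/-- Isomorphism of leaf-labelled rooted trees: a digraph isomorphism preserving
the labels of the leaves (the labels of internal vertices are ignored). -/
inductive LeafIso : RTree ℕ → RTree ℕ → Prop
  | leaf (i : ℕ) : LeafIso (.node i []) (.node i [])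
  | node (i j : ℕ) (ts ts' : List (RTree ℕ)) (hts : ts ≠ [])
      (e : Fin ts.length ≃ Fin ts'.length)
      (h : ∀ idx : Fin ts.length, LeafIso (ts.get idx) (ts'.get (e idx))) :
      LeafIso (.node i ts) (.node j ts')

theorem RTree.ind {K : Type} {p : RTree K → Prop}
    (h : ∀ k ts, (∀ t ∈ ts, p t) → p (.node k ts)) : ∀ t, p t
  | .node k ts => h k ts (fun t _ => RTree.ind h t)

namespace BlAux

open MvPolynomial

variable {S : Type}

theorem leafLabelList_eq (ts : List (RTree ℕ)) :
    leafLabelList (S := S) ts = ts.map leafLabel := by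
  induction ts with
  | nil => simp [leafLabelList]
  | cons t ts ih => simp [leafLabelList, ih]

theorem BlProd_eq (ts : List (RTree ℕ)) :
    BlProd (S := S) ts = (ts.map Bl).prod := by
  induction ts with
  | nil => simp [BlProd]
  | cons t ts ih => simp [BlProd, ih]

theorem Pprod_eq {K : Type} (ts : List (RTree K)) :
    RTree.Pprod ts = (ts.map RTree.P).prod := by
  induction ts with
  | nil => simp [RTree.Pprod]
  | cons t ts ih => simp [RTree.Pprod, ih]

theorem SpecialList_iff (ts : List (RTree (Var S))) :
    SpecialList ts ↔ ∀ t ∈ ts, SpecialAux false t := by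
  induction ts with
  | nil => simp [SpecialList]
  | cons t ts ih => simp [SpecialList, ih]

theorem special (T : RTree ℕ) : ∀ b, SpecialAux (S := S) b (leafLabel T) := by
  induction T using RTree.ind with
  | h k ts ih =>
    intro b
    match ts, ih with
    | [], _ => simp [leafLabel, SpecialAux]
    | [t], ih => simp [leafLabel, leafLabelList, SpecialAux, ih t (by simp)]
    | t₁ :: t₂ :: ts, ih =>
      simp only [leafLabel, leafLabelList, SpecialAux, true_or, true_and]
      rw [SpecialList_iff, leafLabelList_eq]
      intro t ht
      have : t ∈ (t₁ :: t₂ :: ts).map (leafLabel (S := S)) := by simpa using ht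
      obtain ⟨u, hu, rfl⟩ := List.mem_map.1 this
      exact ih u hu false

theorem P_eq (T : RTree ℕ) : (leafLabel (S := S) T).P = Bl T := by
  induction T using RTree.ind with
  | h k ts ih =>
    match ts, ih with
    | [], _ => simp [leafLabel, RTree.P, Bl]
    | t :: ts, ih =>
      simp only [leafLabel, leafLabelList, RTree.P, Bl]
      congr 1
      rw [Pprod_eq, BlProd_eq, leafLabelList_eq, ← List.map_cons, List.map_map]
      congr 1
      exact List.map_congr_left (fun u hu => ih u hu)

/-- weight map: `x i ↦ x i * t`. -/
noncomputable def phi : MvPolynomial (Var S) ℤ →ₐ[ℤ] Polynomial (MvPolynomial (Var S) ℤ) :=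
  aeval (fun v => match v with
    | .x i => Polynomial.C (X (.x i)) * Polynomial.X
    | v => Polynomial.C (X v))

/-- set `y = 0`. -/
noncomputable def psi : MvPolynomial (Var S) ℤ →ₐ[ℤ] MvPolynomial (Var S) ℤ :=
  aeval (fun v => match v with
    | .y => 0
    | v => X v)

/-- value at the origin. -/
noncomputable def ev0 : MvPolynomial (Var S) ℤ →ₐ[ℤ] ℤ := aeval (fun _ => 0)
/-- value at the all-ones point. -/
noncomputable def ev1 : MvPolynomial (Var S) ℤ →ₐ[ℤ] ℤ := aeval (fun _ => 1)

theorem ev0_psi (a : MvPolynomial (Var S) ℤ) : ev0 (psi a) = ev0 a := by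
  have : (ev0.comp psi : MvPolynomial (Var S) ℤ →ₐ[ℤ] ℤ) = ev0 := by
    ext v
    cases v <;> simp [ev0, psi]
  exact DFunLike.congr_fun this a

theorem phi_psi (a : MvPolynomial (Var S) ℤ) :
    phi (psi a) = (phi a).map (psi (S := S)).toRingHom := by
  have : (phi.comp psi : MvPolynomial (Var S) ℤ →ₐ[ℤ] _) =
      (Polynomial.mapAlgHom psi).comp phi := by
    ext1 v
    cases v <;> simp [phi, psi]
  exact DFunLike.congr_fun this a

theorem phi_eval (a : MvPolynomial (Var S) ℤ) : (phi a).eval 1 = a := by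
  have : (((Polynomial.aeval (R := MvPolynomial (Var S) ℤ) 1).restrictScalars ℤ).comp phi :
      MvPolynomial (Var S) ℤ →ₐ[ℤ] MvPolynomial (Var S) ℤ) = AlgHom.id ℤ _ := by
    ext1 v
    cases v <;> simp [phi]
  have h := DFunLike.congr_fun this a
  simpa [Polynomial.aeval_def, Polynomial.eval₂_eq_eval_map] using h

/-- the invariant carried through the induction. -/
structure Good (f : MvPolynomial (Var S) ℤ) : Prop where
  lead : (phi f).leadingCoeff = psi f
  deg : (phi f).natDegree = (phi (psi f)).natDegree
  ne : psi f ≠ 0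
  unit : ∀ b, b ∣ psi f → ev0 b ≠ 0 → IsUnit b

theorem phi_ne {f : MvPolynomial (Var S) ℤ} (h : f ≠ 0) : phi f ≠ 0 := by
  intro h0
  apply h
  rw [← phi_eval f, h0]; simp

theorem Good.ne' {f : MvPolynomial (Var S) ℤ} (h : Good f) : f ≠ 0 := by
  rintro rfl
  exact h.ne (by simp)

theorem Good.one : Good (1 : MvPolynomial (Var S) ℤ) where
  lead := by simp
  deg := by simp
  ne := by simp
  unit := fun b hb _ => isUnit_of_dvd_one (by simpa using hb)

theorem Good.mul {f g : MvPolynomial (Var S) ℤ} (hf : Good f) (hg : Good g) : Good (f * g) where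
  lead := by simp [Polynomial.leadingCoeff_mul, hf.lead, hg.lead]
  deg := by
    simp only [map_mul]
    rw [Polynomial.natDegree_mul (phi_ne hf.ne') (phi_ne hg.ne'),
      Polynomial.natDegree_mul (phi_ne hf.ne) (phi_ne hg.ne), hf.deg, hg.deg]
  ne := by simpa using ⟨hf.ne, hg.ne⟩
  unit := by
    intro b hb h0
    rw [map_mul] at hb
    obtain ⟨b₁, b₂, h₁, h₂, rfl⟩ := exists_dvd_and_dvd_of_dvd_mul hb
    rw [map_mul] at h0
    exact (hf.unit b₁ h₁ (left_ne_zero_of_mul h0)).mul (hg.unit b₂ h₂ (right_ne_zero_of_mul h0))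

theorem Good.add {f : MvPolynomial (Var S) ℤ} (hf : Good f) (hd : 0 < (phi f).natDegree) :
    Good (X Var.y + f) ∧ 0 < (phi (X Var.y + f)).natDegree := by
  have hy : phi (X Var.y : MvPolynomial (Var S) ℤ) = Polynomial.C (X Var.y) := by simp [phi]
  have hpsi : psi (X Var.y + f) = psi f := by simp [psi]
  have hdeg : (phi (X Var.y + f)).natDegree = (phi f).natDegree := by
    rw [map_add, hy, Polynomial.natDegree_C_add]
  refine ⟨⟨?_, ?_, ?_, ?_⟩, by rwa [hdeg]⟩
  · rw [hpsi, ← hf.lead, map_add, hy]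
    apply Polynomial.leadingCoeff_add_of_degree_lt
    exact lt_of_le_of_lt Polynomial.degree_C_le (Polynomial.natDegree_pos_iff_degree_pos.1 hd)
  · rw [hpsi, hdeg, hf.deg]
  · rw [hpsi]; exact hf.ne
  · rw [hpsi]; exact hf.unit

theorem prime_X (v : Var S) : Prime (X v : MvPolynomial (Var S) ℤ) := MvPolynomial.X_prime

theorem Good.leaf (i : ℕ) : Good (X (Var.x i) : MvPolynomial (Var S) ℤ) ∧
    0 < (phi (X (Var.x i) : MvPolynomial (Var S) ℤ)).natDegree := by
  have hpsi : psi (X (Var.x i) : MvPolynomial (Var S) ℤ) = X (Var.x i) := by simp [psi]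
  have hphi : phi (X (Var.x i) : MvPolynomial (Var S) ℤ) =
    Polynomial.C (X (Var.x i)) * Polynomial.X := by simp [phi]
  refine ⟨⟨?_, ?_, ?_, ?_⟩, ?_⟩
  · rw [hpsi, hphi]; simp
  · rw [hpsi]
  · rw [hpsi]; exact (prime_X _).ne_zero
  · rw [hpsi]
    rintro b ⟨c, hc⟩ h0
    rcases (prime_X (S := S) (Var.x i)).irreducible.isUnit_or_isUnit hc with h | h
    · exact h
    · exfalso
      have h1 : ev0 (X (Var.x i) : MvPolynomial (Var S) ℤ) = 0 := by simp [ev0]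
      rw [hc, map_mul] at h1
      exact mul_ne_zero h0 (h.map ev0).ne_zero h1
  · rw [hphi, Polynomial.natDegree_C_mul_X _ (prime_X _).ne_zero]; exact one_pos

theorem good_prod (ts : List (RTree ℕ))
    (h : ∀ t ∈ ts, Good (Bl (S := S) t) ∧ 0 < (phi (Bl (S := S) t)).natDegree) :
    Good (BlProd (S := S) ts) := by
  induction ts with
  | nil => simpa [BlProd] using Good.one
  | cons t ts ih =>
    simp only [BlProd]
    exact (h t (by simp)).1.mul (ih fun u hu => h u (by simp [hu]))

theorem good_Bl (T : RTree ℕ) : Good (Bl (S := S) T) ∧ 0 < (phi (Bl (S := S) T)).natDegree := by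
  induction T using RTree.ind with
  | h k ts ih =>
    match ts, ih with
    | [], _ => simpa only [Bl] using Good.leaf k
    | t :: ts, ih =>
      simp only [Bl]
      apply (good_prod (t :: ts) ih).add
      have h1 := good_prod ts fun u hu => ih u (by simp [hu])
      have h2 := ih t (by simp)
      rw [BlProd, map_mul, Polynomial.natDegree_mul (phi_ne h2.1.ne') (phi_ne h1.ne')]
      omega

theorem ev0_Bl (T : RTree ℕ) : ev0 (Bl (S := S) T) = 0 := by
  induction T using RTree.ind with
  | h k ts ih =>
    match ts, ih with
    | [], _ => simp [Bl, ev0]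
    | t :: ts, ih =>
      have := ih t (by simp)
      simp only [Bl, BlProd, map_add, map_mul, this]
      simp [ev0]

theorem ev1_Bl (T : RTree ℕ) : 0 < ev1 (Bl (S := S) T) := by
  induction T using RTree.ind with
  | h k ts ih =>
    have hp : 0 < ev1 (BlProd (S := S) ts) := by
      clear * - ih
      induction ts with
      | nil => simp [BlProd]
      | cons t ts ih' =>
        rw [BlProd, map_mul]
        exact mul_pos (ih t (by simp)) (ih' fun u hu => ih u (by simp [hu]))
    match ts, hp with
    | [], _ => simp [Bl, ev1]
    | t :: ts, hp =>
      simp only [Bl, map_add]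
      have : ev1 (X Var.y : MvPolynomial (Var S) ℤ) = 1 := by simp [ev1]
      omega

theorem ev1_BlProd (ts : List (RTree ℕ)) : 0 < ev1 (BlProd (S := S) ts) := by
  induction ts with
  | nil => simp [BlProd]
  | cons t ts ih =>
    rw [BlProd, map_mul]
    exact mul_pos (ev1_Bl t) ih

theorem ev0_BlProd (ts : List (RTree ℕ)) : 0 ≤ ev0 (BlProd (S := S) ts) := by
  cases ts with
  | nil => simp [BlProd]
  | cons t ts => simp [BlProd, ev0_Bl]

theorem der_Bl (T : RTree ℕ) : 0 ≤ ev0 (pderiv Var.y (Bl (S := S) T)) ∧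
    ∀ k t ts, T = .node k (t :: ts) → 0 < ev0 (pderiv Var.y (Bl (S := S) T)) := by
  induction T using RTree.ind with
  | h k ts ih =>
    match ts, ih with
    | [], _ =>
      refine ⟨?_, by simp⟩
      simp [Bl]
    | t :: ts, ih =>
      have h : 0 < ev0 (pderiv Var.y (Bl (S := S) (.node k (t :: ts)))) := by
        have h1 := (ih t (by simp)).1
        simp only [Bl, BlProd, map_add, pderiv_mul, map_mul, ev0_Bl, pderiv_X_self, map_one]
        have := mul_nonneg h1 (ev0_BlProd (S := S) ts)
        omega
      exact ⟨h.le, fun _ _ _ _ => h⟩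

theorem unit_of_factor {f a b : MvPolynomial (Var S) ℤ} (hf : Good f) (hab : f = a * b)
    (hb : ev0 b ≠ 0) : IsUnit b := by
  have hpsi : psi f = psi a * psi b := by rw [hab, map_mul]
  have hub : IsUnit (psi b) := hf.unit _ ⟨psi a, by rw [hpsi, mul_comm]⟩ (by rwa [ev0_psi])
  have hne := hf.ne'
  rw [hab] at hne
  have ha0 : a ≠ 0 := left_ne_zero_of_mul hne
  have hb0 : b ≠ 0 := right_ne_zero_of_mul hne
  have hne2 := hf.ne
  rw [hpsi] at hne2
  have hd := hf.deg
  rw [hpsi, hab, map_mul, map_mul, Polynomial.natDegree_mul (phi_ne ha0) (phi_ne hb0),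
    Polynomial.natDegree_mul (phi_ne (left_ne_zero_of_mul hne2))
      (phi_ne (right_ne_zero_of_mul hne2)),
    Polynomial.natDegree_eq_zero_of_isUnit (hub.map phi)] at hd
  have hle : (phi (psi a)).natDegree ≤ (phi a).natDegree := by
    rw [phi_psi]; exact Polynomial.natDegree_map_le
  have hdb : (phi b).natDegree = 0 := by omega
  have hlb : (phi b).leadingCoeff = b := by
    have h1 := Polynomial.eq_C_of_natDegree_eq_zero hdb
    have h2 := phi_eval b
    rw [Polynomial.leadingCoeff, hdb]
    rw [h1, Polynomial.eval_C] at h2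
    exact h2
  apply hf.unit b _ hb
  rw [← hf.lead, hab, map_mul, Polynomial.leadingCoeff_mul, hlb]
  exact dvd_mul_left _ _

theorem irr_Bl (T : RTree ℕ) : Irreducible (Bl (S := S) T) := by
  match T with
  | .node k [] => simpa only [Bl] using (prime_X _).irreducible
  | .node k (t :: ts) =>
    have h0 := ev0_Bl (S := S) (.node k (t :: ts))
    have h1 := (der_Bl (S := S) (.node k (t :: ts))).2 k t ts rfl
    have hg := (good_Bl (S := S) (.node k (t :: ts))).1
    generalize Bl (S := S) (.node k (t :: ts)) = f at *
    refine ⟨fun hu => (hu.map ev0).ne_zero h0, ?_⟩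
    intro a b hab
    by_cases hb : ev0 b = 0
    · by_cases ha : ev0 a = 0
      · rw [hab, pderiv_mul, map_add, map_mul, map_mul, ha, hb] at h1
        simp at h1
      · exact Or.inl (unit_of_factor hg (hab.trans (mul_comm _ _)) ha)
    · exact Or.inr (unit_of_factor hg hab hb)

theorem eq_of_assoc {T T' : RTree ℕ} (h : Associated (Bl (S := S) T) (Bl T')) :
    Bl (S := S) T = Bl T' := by
  obtain ⟨u, hu⟩ := h
  have h1 := ev1_Bl (S := S) T
  have h2 := ev1_Bl (S := S) T'
  obtain ⟨r, hr, hr'⟩ := MvPolynomial.isUnit_iff_eq_C_of_isReduced.1 u.isUnit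
  rcases Int.isUnit_iff.1 hr with rfl | rfl
  · rw [← hu, hr']; simp
  · rw [← hu, hr'] at h2
    simp at h2
    omega

theorem perm_of_prod {ts ts' : List (RTree ℕ)} (h : BlProd (S := S) ts = BlProd ts') :
    (ts.map (Bl (S := S))).Perm (ts'.map Bl) := by
  rw [BlProd_eq, BlProd_eq] at h
  have hr := UniqueFactorizationMonoid.factors_unique
    (f := (↑(ts.map (Bl (S := S))) : Multiset (MvPolynomial (Var S) ℤ)))
    (g := (↑(ts'.map (Bl (S := S))) : Multiset (MvPolynomial (Var S) ℤ)))
    (by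
      intro x hx
      obtain ⟨t, _, rfl⟩ := List.mem_map.1 (Multiset.mem_coe.1 hx)
      exact irr_Bl t)
    (by
      intro x hx
      obtain ⟨t, _, rfl⟩ := List.mem_map.1 (Multiset.mem_coe.1 hx)
      exact irr_Bl t)
    (by rw [Multiset.prod_coe, Multiset.prod_coe, h]; exact Associated.refl _)
  rw [← Multiset.coe_eq_coe, ← Multiset.rel_eq]
  refine hr.mono ?_
  intro a ha b hb hab
  obtain ⟨t, _, rfl⟩ := List.mem_map.1 (Multiset.mem_coe.1 ha)
  obtain ⟨t', _, rfl⟩ := List.mem_map.1 (Multiset.mem_coe.1 hb)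
  exact eq_of_assoc hab

theorem perm_equiv {α : Type*} {l l' : List α} (h : l.Perm l') :
    ∃ e : Fin l.length ≃ Fin l'.length, ∀ i, l.get i = l'.get (e i) := by
  classical
  have hc : ∀ a : α, Nonempty ({i : Fin l.length // l.get i = a} ≃
      {i : Fin l'.length // l'.get i = a}) := by
    intro a
    rw [← Fintype.card_eq, Fintype.card_subtype, Fintype.card_subtype]
    have key : ∀ m : List α, (Finset.univ.filter fun i : Fin m.length => m.get i = a).card
        = m.count a := by
      intro m
      have h2 := List.count_eq_countP (a := a) (l := m)
      conv_rhs => rw [← List.ofFn_get m]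
      rw [← Multiset.coe_count, ← Fin.univ_val_map, Multiset.count_map]
      simp [Finset.card, eq_comm]
    rw [key, key, h.count_eq]
  have e := fun a => (hc a).some
  refine ⟨(Equiv.sigmaFiberEquiv l.get).symm.trans
    ((Equiv.sigmaCongrRight e).trans (Equiv.sigmaFiberEquiv l'.get)), ?_⟩
  intro i
  exact ((e (l.get i)) ⟨i, rfl⟩).2.symm

theorem iso_of_eq (T : RTree ℕ) : ∀ T', Bl (S := S) T = Bl T' → LeafIso T T' := by
  have key : ∀ i k t ts, Bl (S := S) (.node i []) ≠ Bl (.node k (t :: ts)) := by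
    intro i k t ts h
    have h1 := congrArg ev1 h
    simp only [Bl, map_add] at h1
    have h2 := ev1_BlProd (S := S) (t :: ts)
    have h3 : ∀ v, ev1 (X v : MvPolynomial (Var S) ℤ) = 1 := by simp [ev1]
    rw [h3, h3] at h1
    omega
  induction T using RTree.ind with
  | h k ts ih =>
    rintro ⟨k', ts'⟩ h
    match ts, ts', ih, h with
    | [], [], _, h =>
      simp only [Bl] at h
      have := X_injective h
      cases this
      exact .leaf k
    | [], t' :: ts', _, h => exact absurd h (key _ _ _ _)
    | t :: ts, [], _, h => exact absurd h.symm (key _ _ _ _)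
    | t :: ts, t' :: ts', ih, h =>
      simp only [Bl] at h
      obtain ⟨e, he⟩ := perm_equiv (perm_of_prod (add_left_cancel h))
      refine .node k k' _ _ (by simp)
        (((finCongr (List.length_map _)).symm.trans e).trans (finCongr (List.length_map _))) ?_
      intro idx
      apply ih _ (List.get_mem _ _)
      have := he (Fin.cast (List.length_map _).symm idx)
      simpa [-List.map_cons] using this

theorem eq_of_iso {T T' : RTree ℕ} (h : LeafIso T T') : Bl (S := S) T = Bl T' := by
  induction h with
  | leaf i => rfl
  | node i j ts ts' hts e h ih =>
    have hp : BlProd (S := S) ts = BlProd ts' := by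
      have : ∀ l : List (RTree ℕ), BlProd (S := S) l = ∏ i, Bl (l.get i) := by
        intro l
        rw [BlProd_eq, ← List.prod_ofFn]
        congr 1
        conv_lhs => rw [← List.ofFn_get l, List.map_ofFn]
        rfl
      rw [this, this]
      exact Fintype.prod_equiv e _ _ ih
    match ts, ts', hts, e, hp with
    | t :: ts, t' :: ts', _, _, hp => simp only [Bl, hp]
    | t :: ts, [], _, e, _ => exact (e ⟨0, by simp⟩).elim0
    | [], _, hts, _, _ => exact absurd rfl hts

end BlAux

/-- Let `T` be a rooted tree with a leaf-labelling
`φ : L(T) → {x_1,…,x_n}` and let `λ_L` label internal vertices by `y` and each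
leaf `v` by `φ(v)`. Then `(T,λ_L)` is a special pair, `P(T,λ_L) = B_l(T)`, and
`B_l` is a complete invariant for leaf-labelled rooted trees: `B_l(T) = B_l(T')`
iff there is a digraph isomorphism between `T` and `T'` preserving leaf labels. -/
theorem Bl_complete_invariant {S : Type} (T T' : RTree ℕ) :
    IsSpecial (S := S) (leafLabel T) ∧ (leafLabel (S := S) T).P = Bl T ∧
      (Bl (S := S) T = Bl T' ↔ LeafIso T T') := by
  exact ⟨BlAux.special T false, BlAux.P_eq T, BlAux.iso_of_eq T T', BlAux.eq_of_iso⟩
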